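/- For fixed logits l ∈ ℝ^L, the entropy of the temperature-τ softmax of l is a nondecreasing function of τ on (0, ∞), and is strictly increasing unless all entries of l are equal. -/

import Mathlib

open Real Finset

noncomputable def softmax (L : ℕ) (τ : ℝ) (l : Fin L → ℝ) (i : Fin L) : ℝ :=
  Real.exp (l i / τ) / ∑ j, Real.exp (l j / τ)

theorem sum_mul_log_lt_sum_mul_log_self {ι : Type*} [Fintype ι] {p q : ι → ℝ}
    (hp : ∀ i, 0 < p i) (hq : ∀ i, 0 < q i) (h : ∑ i, p i = ∑ i, q i) (hne : p ≠ q) :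
    ∑ i, p i * Real.log (q i) < ∑ i, p i * Real.log (p i) := by
  have key : ∀ i, p i * Real.log (q i) ≤ p i * Real.log (p i) + (q i - p i) ∧
      (p i ≠ q i → p i * Real.log (q i) < p i * Real.log (p i) + (q i - p i)) := fun i => by
    have h3 : p i * (q i / p i) = q i := mul_div_cancel₀ _ (hp i).ne'
    have hpos := div_pos (hq i) (hp i)
    refine ⟨?_, fun hi => ?_⟩
    · have h1 := Real.log_le_sub_one_of_pos hpos
      rw [Real.log_div (hq i).ne' (hp i).ne'] at h1
      have h2 := mul_le_mul_of_nonneg_left h1 (hp i).le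
      linarith
    · have h1 := Real.log_lt_sub_one_of_pos hpos
        fun h => hi ((div_eq_one_iff_eq (hp i).ne').1 h).symm
      rw [Real.log_div (hq i).ne' (hp i).ne'] at h1
      have h2 := mul_lt_mul_of_pos_left h1 (hp i)
      linarith
  obtain ⟨i, hi⟩ := Function.ne_iff.1 hne
  have hs := Finset.sum_lt_sum (fun i (_ : i ∈ Finset.univ) => (key i).1)
    ⟨i, Finset.mem_univ i, (key i).2 hi⟩
  rw [Finset.sum_add_distrib, Finset.sum_sub_distrib] at hs
  linarith

theorem sum_mul_log_le_sum_mul_log_self {ι : Type*} [Fintype ι] {p q : ι → ℝ}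
    (hp : ∀ i, 0 < p i) (hq : ∀ i, 0 < q i) (h : ∑ i, p i = ∑ i, q i) :
    ∑ i, p i * Real.log (q i) ≤ ∑ i, p i * Real.log (p i) := by
  rcases eq_or_ne p q with rfl | hne
  · exact le_rfl
  · exact (sum_mul_log_lt_sum_mul_log_self hp hq h hne).le

theorem sum_exp_div_pos {L : ℕ} (hL : 1 ≤ L) (τ : ℝ) (l : Fin L → ℝ) :
    0 < ∑ j, Real.exp (l j / τ) :=
  Finset.sum_pos (fun _ _ => Real.exp_pos _) ⟨⟨0, hL⟩, Finset.mem_univ _⟩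

theorem softmax_pos {L : ℕ} (hL : 1 ≤ L) (τ : ℝ) (l : Fin L → ℝ) (i : Fin L) :
    0 < softmax L τ l i :=
  div_pos (Real.exp_pos _) (sum_exp_div_pos hL τ l)

theorem sum_softmax {L : ℕ} (hL : 1 ≤ L) (τ : ℝ) (l : Fin L → ℝ) :
    ∑ i, softmax L τ l i = 1 := by
  simp only [softmax, ← Finset.sum_div]
  exact div_self (sum_exp_div_pos hL τ l).ne'

theorem log_softmax {L : ℕ} (hL : 1 ≤ L) (τ : ℝ) (l : Fin L → ℝ) (i : Fin L) :
    Real.log (softmax L τ l i) = τ⁻¹ * l i - Real.log (∑ j, Real.exp (l j / τ)) := by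
  rw [softmax, Real.log_div (Real.exp_pos _).ne' (sum_exp_div_pos hL τ l).ne', Real.log_exp,
    div_eq_inv_mul]

theorem sum_softmax_mul_log_softmax {L : ℕ} (hL : 1 ≤ L) (σ τ : ℝ) (l : Fin L → ℝ) :
    ∑ i, softmax L σ l i * Real.log (softmax L τ l i) =
      τ⁻¹ * ∑ i, softmax L σ l i * l i - Real.log (∑ j, Real.exp (l j / τ)) := by
  simp only [log_softmax hL, mul_sub, Finset.sum_sub_distrib, ← Finset.sum_mul, sum_softmax hL,
    one_mul, Finset.mul_sum]
  congr 1
  exact Finset.sum_congr rfl fun i _ => by ring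

theorem sum_softmax_mul_antitoneOn {L : ℕ} (hL : 1 ≤ L) (l : Fin L → ℝ) :
    AntitoneOn (fun τ => ∑ i, softmax L τ l i * l i) (Set.Ioi (0 : ℝ)) := by
  intro σ hσ τ _ hle
  rcases hle.eq_or_lt with rfl | hlt
  · exact le_rfl
  have hinv : τ⁻¹ < σ⁻¹ := inv_strictAnti₀ hσ hlt
  have hsum : ∑ i, softmax L σ l i = ∑ i, softmax L τ l i := by
    rw [sum_softmax hL, sum_softmax hL]
  have h1 := sum_mul_log_le_sum_mul_log_self (softmax_pos hL σ l) (softmax_pos hL τ l) hsum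
  have h2 := sum_mul_log_le_sum_mul_log_self (softmax_pos hL τ l) (softmax_pos hL σ l) hsum.symm
  simp only [sum_softmax_mul_log_softmax hL] at h1 h2
  refine le_of_mul_le_mul_left ?_ (sub_pos.2 hinv)
  linarith

theorem softmax_ne_softmax {L : ℕ} (hL : 1 ≤ L) {l : Fin L → ℝ} (hl : ¬ ∀ i j, l i = l j)
    {σ τ : ℝ} (hne : σ ≠ τ) : softmax L σ l ≠ softmax L τ l := by
  intro h
  refine hl fun i j => ?_
  have hi := congrArg Real.log (congrFun h i)
  have hj := congrArg Real.log (congrFun h j)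
  rw [log_softmax hL, log_softmax hL] at hi hj
  refine mul_left_cancel₀ (sub_ne_zero.2 (inv_injective.ne hne)) ?_
  linarith

theorem softmax_entropy_monotone_in_temp (L : ℕ) (hL : 1 ≤ L) (l : Fin L → ℝ) :
    MonotoneOn
      (fun τ => -∑ i, softmax L τ l i * Real.log (softmax L τ l i))
      (Set.Ioi (0 : ℝ)) ∧
    (¬ (∀ i j, l i = l j) →
      StrictMonoOn
        (fun τ => -∑ i, softmax L τ l i * Real.log (softmax L τ l i))
        (Set.Ioi (0 : ℝ))) := by
  have hsum (σ τ : ℝ) : ∑ i, softmax L σ l i = ∑ i, softmax L τ l i := by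
    rw [sum_softmax hL, sum_softmax hL]
  refine ⟨fun σ hσ τ hτ hle => ?_, fun hl σ hσ τ hτ hlt => ?_⟩
  · have hmean := mul_le_mul_of_nonneg_left (sum_softmax_mul_antitoneOn hL l hσ hτ hle)
      (inv_pos.2 hτ).le
    have hgibbs := sum_mul_log_le_sum_mul_log_self (softmax_pos hL σ l) (softmax_pos hL τ l)
      (hsum σ τ)
    have hcross := sum_softmax_mul_log_softmax hL σ τ l
    have hself := sum_softmax_mul_log_softmax hL τ τ l
    dsimp only at hmean ⊢
    linarith
  · have hmean := mul_le_mul_of_nonneg_left (sum_softmax_mul_antitoneOn hL l hσ hτ hlt.le)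
      (inv_pos.2 hτ).le
    have hgibbs := sum_mul_log_lt_sum_mul_log_self (softmax_pos hL σ l) (softmax_pos hL τ l)
      (hsum σ τ) (softmax_ne_softmax hL hl hlt.ne)
    have hcross := sum_softmax_mul_log_softmax hL σ τ l
    have hself := sum_softmax_mul_log_softmax hL τ τ l
    dsimp only at hmean ⊢
    linarith
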